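/- Let p ≥ 0, 0 ≤ q < n and 0 ≤ k ≤ n − q be integers, and assume ℋ^b_p ≠ 0. Define f_{k,p,q} = ∑_{i=0}^k C(k,i) ((n−q−i)! / Γ(m/2 + p + k − i)) x̲^{2(k−i)} x`^{2i}. Then: (i) Δ(f_{k,p,q} · H^b H^f) = 0 for all H^b ∈ ℋ^b_p and H^f ∈ ℋ^f_q; (ii) the space f_{k,p,q}·(ℋ^b_p · ℋ^f_q) is nonzero; (iii) f_{k,p,q} is the unique element of the form ∑_{i=0}^k a_i x̲^{2(k−i)} x`^{2i} with a_i ∈ ℝ satisfying (i) and (ii) and having leading coefficient a_0 = (n−q)! / Γ(m/2 + p + k). -/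

import Mathlib

set_option synthInstance.maxHeartbeats 1000000
set_option maxHeartbeats 1000000
open scoped TensorProduct
open MvPolynomial

noncomputable section

variable (m n : ℕ)

/-- The Grassmann algebra Λ_{2n} on `2n` anticommuting generators. -/
abbrev Grass (n : ℕ) := ExteriorAlgebra ℝ (Fin (2*n) → ℝ)

/-- The algebra of super-polynomials 𝒫 = ℝ[x_1,…,x_m] ⊗ Λ_{2n}. -/
abbrev SuperPoly (m n : ℕ) := MvPolynomial (Fin m) ℝ ⊗[ℝ] Grass n

/-- The fermionic generator x`_i. -/
def fgen (i : Fin (2*n)) : Grass n :=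
  ExteriorAlgebra.ι ℝ (Pi.single i (1:ℝ))

/-- The fermionic partial derivative ∂_{x`_i}, the odd derivation with
∂_{x`_i}(x`_j) = δ_{ij}: contraction with the i-th dual basis vector. -/
def fpderiv (i : Fin (2*n)) : Grass n →ₗ[ℝ] Grass n :=
  CliffordAlgebra.contractLeft (LinearMap.proj i)

/-- The fermionic Laplace operator on Λ_{2n}. -/
def lapF : Grass n →ₗ[ℝ] Grass n :=
  (4:ℝ) • ∑ j : Fin n,
    (fpderiv n ⟨2*j.1, by omega⟩) ∘ₗ (fpderiv n ⟨2*j.1+1, by omega⟩)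

/-- The bosonic Laplace operator Δ_b = −∑ ∂_{x_j}² on ℝ[x_1,…,x_m]. -/
def lapB : MvPolynomial (Fin m) ℝ →ₗ[ℝ] MvPolynomial (Fin m) ℝ :=
  - ∑ j : Fin m, (pderiv j).toLinearMap ∘ₗ (pderiv j).toLinearMap

/-- The super Laplace operator Δ = Δ_b + Δ_f on 𝒫. -/
def lap : SuperPoly m n →ₗ[ℝ] SuperPoly m n :=
  LinearMap.rTensor (Grass n) (lapB m) + LinearMap.lTensor (MvPolynomial (Fin m) ℝ) (lapF n)

/-- x̲² = −∑ x_j². -/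
def rb2 : MvPolynomial (Fin m) ℝ := - ∑ j : Fin m, (X j)^2

/-- x`² = ∑_{j=1}^n x`_{2j−1} x`_{2j}. -/
def rf2 : Grass n := ∑ j : Fin n, fgen n ⟨2*j.1, by omega⟩ * fgen n ⟨2*j.1+1, by omega⟩

/-- The generalized norm squared x² = x̲² + x`² as an element of 𝒫. -/
def r2 : SuperPoly m n := (rb2 m) ⊗ₜ 1 + 1 ⊗ₜ (rf2 n)

/-- The grade-`i` part of the Grassmann algebra. -/
def fgrade (i : ℕ) : Submodule ℝ (Grass n) :=
  (LinearMap.range (ExteriorAlgebra.ι ℝ (M := Fin (2*n) → ℝ)))^i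

/-- The space 𝒫_k of super-polynomials homogeneous of total degree k. -/
def P (k : ℕ) : Submodule ℝ (SuperPoly m n) :=
  ⨆ i : Fin (k+1), Submodule.map₂ (TensorProduct.mk ℝ _ _)
    (homogeneousSubmodule (Fin m) ℝ (k - i.1)) (fgrade n i.1)

/-- The space ℋ_k of spherical harmonics of degree k. -/
def H (k : ℕ) : Submodule ℝ (SuperPoly m n) :=
  P m n k ⊓ LinearMap.ker (lap m n)

/-- The super-dimension M = m − 2n. -/
def sdim : ℤ := (m : ℤ) - 2*n

/-- ℋ^b_p: classical harmonic polynomials of degree p in x_1,…,x_m. -/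
def Hb (p : ℕ) : Submodule ℝ (MvPolynomial (Fin m) ℝ) :=
  homogeneousSubmodule (Fin m) ℝ p ⊓ LinearMap.ker (lapB m)

/-- ℋ^f_q: fermionic (symplectic) harmonics of degree q. -/
def Hf (q : ℕ) : Submodule ℝ (Grass n) :=
  fgrade n q ⊓ LinearMap.ker (lapF n)

/-- ℋ^b_p · ℋ^f_q: the span in 𝒫 of the products H^b H^f. -/
def HbHf (p q : ℕ) : Submodule ℝ (SuperPoly m n) :=
  Submodule.map₂ (TensorProduct.mk ℝ _ _) (Hb m p) (Hf n q)

/-- The polynomial f_{k,p,q} = ∑_{i=0}^k C(k,i)((n−q−i)!/Γ(m/2+p+k−i)) x̲^{2(k−i)} x`^{2i}. -/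
def fkpq (m n k p q : ℕ) : SuperPoly m n :=
  ∑ i ∈ Finset.range (k+1),
    ((Nat.choose k i : ℝ) * ((n - q - i).factorial : ℝ) /
        Real.Gamma ((m:ℝ)/2 + p + k - i)) • (((rb2 m)^(k-i)) ⊗ₜ[ℝ] ((rf2 n)^i))

section Fermionic

variable {n}

lemma fpderiv_ι_mul (i : Fin (2*n)) (v : Fin (2*n) → ℝ) (ω : Grass n) :
    fpderiv n i (ExteriorAlgebra.ι ℝ v * ω) =
      v i • ω - ExteriorAlgebra.ι ℝ v * fpderiv n i ω :=
  CliffordAlgebra.contractLeft_ι_mul _ _ _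

lemma fpderiv_one (i : Fin (2*n)) : fpderiv n i 1 = 0 :=
  CliffordAlgebra.contractLeft_one _ _

lemma fpderiv_fgen_mul_self (i : Fin (2*n)) (ω : Grass n) :
    fpderiv n i (fgen n i * ω) = ω - fgen n i * fpderiv n i ω := by
  rw [fgen, fpderiv_ι_mul]; simp

lemma fpderiv_fgen_mul_of_ne {i j : Fin (2*n)} (h : i ≠ j) (ω : Grass n) :
    fpderiv n i (fgen n j * ω) = - (fgen n j * fpderiv n i ω) := by
  rw [fgen, fpderiv_ι_mul]; simp [h]

/-- The Euler operator on the Grassmann algebra. -/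
def eulerF (n : ℕ) (ω : Grass n) : Grass n :=
  ∑ j : Fin n, (fgen n ⟨2*j.1, by omega⟩ * fpderiv n ⟨2*j.1, by omega⟩ ω +
    fgen n ⟨2*j.1+1, by omega⟩ * fpderiv n ⟨2*j.1+1, by omega⟩ ω)

lemma ι_eq_sum_smul_fgen (v : Fin (2*n) → ℝ) :
    ExteriorAlgebra.ι ℝ v = ∑ j : Fin n, (v ⟨2*j.1, by omega⟩ • fgen n ⟨2*j.1, by omega⟩ +
      v ⟨2*j.1+1, by omega⟩ • fgen n ⟨2*j.1+1, by omega⟩) := by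
  simp only [fgen, ← map_smul, ← map_add, ← map_sum]
  congr 1
  ext i
  have hi := i.2
  simp only [Finset.sum_apply, Pi.add_apply, Pi.smul_apply, Pi.single_apply, smul_eq_mul,
    Fin.ext_iff]
  rw [Finset.sum_eq_single ⟨i.1 / 2, by omega⟩]
  · rcases Nat.mod_two_eq_zero_or_one i.1 with h | h
    · have h1 : i.1 = 2 * (i.1 / 2) := by omega
      have h2 : i.1 ≠ 2 * (i.1 / 2) + 1 := by omega
      simp only [← h1, if_true]
      simp
    · have h1 : i.1 ≠ 2 * (i.1 / 2) := by omega
      have h2 : i.1 = 2 * (i.1 / 2) + 1 := by omega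
      simp only [← h2, if_true, if_neg h1]
      simp
  · intro j _ hj
    have hj' : j.1 ≠ i.1 / 2 := fun h => hj (Fin.ext h)
    rw [if_neg (by omega), if_neg (by omega)]
    simp
  · simp

lemma eulerF_ι_mul (v : Fin (2*n) → ℝ) (ω : Grass n) :
    eulerF n (ExteriorAlgebra.ι ℝ v * ω) =
      ExteriorAlgebra.ι ℝ v * ω + ExteriorAlgebra.ι ℝ v * eulerF n ω := by
  have key (i : Fin (2*n)) : fgen n i * fpderiv n i (ExteriorAlgebra.ι ℝ v * ω) =
      v i • fgen n i * ω + ExteriorAlgebra.ι ℝ v * (fgen n i * fpderiv n i ω) := by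
    have anti : fgen n i * ExteriorAlgebra.ι ℝ v = - (ExteriorAlgebra.ι ℝ v * fgen n i) :=
      eq_neg_of_add_eq_zero_left (ExteriorAlgebra.ι_add_mul_swap _ _)
    rw [fpderiv_ι_mul, mul_sub, ← mul_assoc, anti, mul_smul_comm, smul_mul_assoc]
    simp only [neg_mul, sub_neg_eq_add, mul_assoc]
  simp only [eulerF, key]
  conv_rhs => rw [ι_eq_sum_smul_fgen v, Finset.sum_mul, ← ι_eq_sum_smul_fgen v]
  rw [Finset.mul_sum, ← Finset.sum_add_distrib]
  refine Finset.sum_congr rfl fun j _ => ?_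
  rw [add_mul, mul_add]
  abel

lemma eulerF_add (ω η : Grass n) : eulerF n (ω + η) = eulerF n ω + eulerF n η := by
  simp only [eulerF, map_add, mul_add, ← Finset.sum_add_distrib]
  exact Finset.sum_congr rfl fun j _ => by abel

lemma eulerF_of_mem_fgrade {d : ℕ} {ω : Grass n} (h : ω ∈ fgrade n d) :
    eulerF n ω = (d : ℝ) • ω := by
  induction d generalizing ω with
  | zero =>
    rw [fgrade, pow_zero, Submodule.mem_one] at h
    obtain ⟨r, rfl⟩ := h
    simp [eulerF, Algebra.algebraMap_eq_smul_one, fpderiv_one]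
  | succ d ih =>
    rw [fgrade, pow_succ'] at h
    induction h using Submodule.mul_induction_on' with
    | mem_mul_mem a ha b hb =>
      obtain ⟨v, rfl⟩ := ha
      rw [eulerF_ι_mul, ih hb, mul_smul_comm]
      push_cast
      rw [add_smul, one_smul, add_comm]
    | add a _ b _ iha ihb => rw [eulerF_add, iha, ihb, smul_add]

lemma fpderiv_fpderiv_pair_self {i j : Fin (2*n)} (h : i ≠ j) (ω : Grass n) :
    fpderiv n i (fpderiv n j (fgen n i * fgen n j * ω)) =
      fgen n i * fgen n j * fpderiv n i (fpderiv n j ω) - ω +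
        (fgen n i * fpderiv n i ω + fgen n j * fpderiv n j ω) := by
  rw [mul_assoc, fpderiv_fgen_mul_of_ne h.symm, fpderiv_fgen_mul_self, map_neg,
    fpderiv_fgen_mul_self, map_sub, fpderiv_fgen_mul_of_ne h]
  simp only [mul_sub, mul_neg, mul_assoc]
  abel

lemma fpderiv_pair_of_ne {i c d : Fin (2*n)} (hc : i ≠ c) (hd : i ≠ d) (ω : Grass n) :
    fpderiv n i (fgen n c * fgen n d * ω) = fgen n c * fgen n d * fpderiv n i ω := by
  rw [mul_assoc, fpderiv_fgen_mul_of_ne hc, fpderiv_fgen_mul_of_ne hd]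
  simp [mul_assoc]

lemma lapF_apply (ω : Grass n) : lapF n ω = (4:ℝ) • ∑ j : Fin n,
    fpderiv n ⟨2*j.1, by omega⟩ (fpderiv n ⟨2*j.1+1, by omega⟩ ω) := by
  simp [lapF]

lemma lapF_rf2_mul (ω : Grass n) :
    lapF n (rf2 n * ω) = rf2 n * lapF n ω + (4:ℝ) • (eulerF n ω - (n:ℝ) • ω) := by
  have key (j : Fin n) : fpderiv n ⟨2*j.1, by omega⟩ (fpderiv n ⟨2*j.1+1, by omega⟩
      (rf2 n * ω)) = rf2 n * fpderiv n ⟨2*j.1, by omega⟩ (fpderiv n ⟨2*j.1+1, by omega⟩ ω) +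
      ((fgen n ⟨2*j.1, by omega⟩ * fpderiv n ⟨2*j.1, by omega⟩ ω +
        fgen n ⟨2*j.1+1, by omega⟩ * fpderiv n ⟨2*j.1+1, by omega⟩ ω) - ω) := by
    rw [← sub_eq_iff_eq_add']
    simp only [rf2, Finset.sum_mul, map_sum]
    rw [← Finset.sum_sub_distrib, Finset.sum_eq_single j]
    · rw [fpderiv_fpderiv_pair_self (by simp [Fin.ext_iff])]
      abel
    · intro l _ hl
      have hl' : j.1 ≠ l.1 := fun h => hl (Fin.ext h.symm)
      rw [fpderiv_pair_of_ne, fpderiv_pair_of_ne, sub_self] <;>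
        simp only [ne_eq, Fin.mk.injEq] <;> omega
    · simp
  rw [lapF_apply, lapF_apply, mul_smul_comm, ← smul_add, Finset.mul_sum]
  simp only [key, Finset.sum_add_distrib, Finset.sum_sub_distrib, eulerF, Finset.sum_const,
    Finset.card_univ, Fintype.card_fin, Nat.cast_smul_eq_nsmul]

lemma rf2_mul_mem_fgrade {d : ℕ} {ω : Grass n} (h : ω ∈ fgrade n d) :
    rf2 n * ω ∈ fgrade n (d + 2) := by
  rw [rf2, Finset.sum_mul]
  refine Submodule.sum_mem _ fun j _ => ?_
  rw [mul_assoc, fgrade, pow_succ', pow_succ']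
  exact Submodule.mul_mem_mul ⟨_, rfl⟩ (Submodule.mul_mem_mul ⟨_, rfl⟩ h)

lemma rf2_pow_mul_mem_fgrade {d : ℕ} {ω : Grass n} (h : ω ∈ fgrade n d) (i : ℕ) :
    rf2 n ^ i * ω ∈ fgrade n (d + 2 * i) := by
  induction i with
  | zero => simpa using h
  | succ i ih =>
    rw [pow_succ', mul_assoc, mul_add, ← add_assoc]
    exact rf2_mul_mem_fgrade ih

lemma lapF_rf2_pow_mul {q : ℕ} {ω : Grass n} (h : ω ∈ Hf n q) (i : ℕ) :
    lapF n (rf2 n ^ (i + 1) * ω) =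
      (4 * (i + 1) * ((q:ℝ) + i - n)) • (rf2 n ^ i * ω) := by
  obtain ⟨hg, hk⟩ := h
  have step (i : ℕ) : lapF n (rf2 n ^ (i + 1) * ω) = rf2 n * lapF n (rf2 n ^ i * ω) +
      (4 * ((q:ℝ) + 2 * i - n)) • (rf2 n ^ i * ω) := by
    rw [pow_succ', mul_assoc, lapF_rf2_mul, eulerF_of_mem_fgrade (rf2_pow_mul_mem_fgrade hg i),
      ← sub_smul, smul_smul]
    push_cast
    rfl
  induction i with
  | zero => rw [step]; simp [LinearMap.mem_ker.mp hk]
  | succ i ih =>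
    rw [step, ih, mul_smul_comm, ← mul_assoc, ← pow_succ', ← add_smul]
    push_cast
    congr 1
    ring

lemma rf2_pow_mul_ne_zero {q : ℕ} {ω : Grass n} (h : ω ∈ Hf n q) (h0 : ω ≠ 0) {i : ℕ}
    (hi : q + i ≤ n) : rf2 n ^ i * ω ≠ 0 := by
  induction i with
  | zero => simpa using h0
  | succ i ih =>
    intro hz
    have hlap := lapF_rf2_pow_mul h i
    rw [hz, map_zero, eq_comm, smul_eq_zero] at hlap
    refine hlap.elim (fun hc => ?_) (ih (by omega))
    have hlt : (q:ℝ) + i + 1 ≤ n := by exact_mod_cast hi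
    have hpos : (0:ℝ) < i + 1 := by positivity
    nlinarith

lemma exists_mem_Hf_ne_zero {q : ℕ} (hq : q ≤ n) : ∃ ω ∈ Hf n q, ω ≠ 0 := by
  suffices h : ∃ ω ∈ fgrade n q, ω ≠ 0 ∧
      ∀ i : Fin (2*n), (i.1 % 2 = 1 ∨ 2 * q ≤ i.1) → fpderiv n i ω = 0 by
    obtain ⟨ω, hg, h0, hd⟩ := h
    refine ⟨ω, ⟨hg, ?_⟩, h0⟩
    change lapF n ω = 0
    rw [lapF_apply, Finset.sum_eq_zero, smul_zero]
    intro j _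
    rw [hd ⟨2*j.1+1, by omega⟩ (Or.inl (by simp only []; omega)), map_zero]
  induction q with
  | zero =>
    refine ⟨1, ?_, one_ne_zero, fun i _ => fpderiv_one i⟩
    rw [fgrade, pow_zero]
    exact Submodule.one_le.mp le_rfl
  | succ q ih =>
    obtain ⟨ω, hg, h0, hd⟩ := ih (by omega)
    refine ⟨fgen n ⟨2*q, by omega⟩ * ω, ?_, fun hz => h0 ?_, fun i hi => ?_⟩
    · rw [fgrade, pow_succ']
      exact Submodule.mul_mem_mul ⟨_, rfl⟩ hg
    · have := fpderiv_fgen_mul_self ⟨2*q, by omega⟩ ω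
      rw [hz, map_zero, hd _ (Or.inr le_rfl), mul_zero, sub_zero] at this
      exact this.symm
    · rw [fpderiv_fgen_mul_of_ne, hd i (by omega), mul_zero, neg_zero]
      intro h
      have := congrArg Fin.val h
      simp only at this
      omega

end Fermionic

section Bosonic

variable {m}

lemma lapB_apply (f : MvPolynomial (Fin m) ℝ) :
    lapB m f = - ∑ j, pderiv j (pderiv j f) := by
  simp [lapB]

lemma pderiv_rb2 (j : Fin m) : pderiv j (rb2 m) = -2 * X j := by
  rw [rb2, map_neg, map_sum, Finset.sum_eq_single j]
  · simp
  · intro i _ hi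
    simp [hi]
  · simp

lemma lapB_rb2_mul {d : ℕ} {f : MvPolynomial (Fin m) ℝ} (h : f.IsHomogeneous d) :
    lapB m (rb2 m * f) = rb2 m * lapB m f + (2 * (m:ℝ) + 4 * d) • f := by
  have key (j : Fin m) : pderiv j (pderiv j (rb2 m * f)) =
      rb2 m * pderiv j (pderiv j f) - (2 * f + 4 * (X j * pderiv j f)) := by
    have h2 : pderiv j (-2 : MvPolynomial (Fin m) ℝ) = 0 := by
      rw [map_neg, neg_eq_zero]
      exact Derivation.map_natCast (pderiv j) 2
    simp only [Derivation.leibniz, map_add, pderiv_rb2, smul_eq_mul, pderiv_X_self, h2]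
    ring
  rw [lapB_apply, lapB_apply]
  simp only [key, Finset.sum_sub_distrib, Finset.sum_add_distrib, ← Finset.mul_sum,
    h.sum_X_mul_pderiv, Finset.sum_const, Finset.card_univ, Fintype.card_fin, smul_eq_C_mul,
    nsmul_eq_mul, map_add, map_mul, map_natCast, map_ofNat]
  ring

lemma rb2_isHomogeneous : (rb2 m).IsHomogeneous 2 :=
  (IsHomogeneous.sum _ _ _ fun j _ => isHomogeneous_X_pow j 2).neg

lemma rb2_pow_mul_isHomogeneous {p : ℕ} {f : MvPolynomial (Fin m) ℝ} (h : f.IsHomogeneous p)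
    (i : ℕ) : (rb2 m ^ i * f).IsHomogeneous (2 * i + p) :=
  (rb2_isHomogeneous.pow i).mul h

lemma rb2_ne_zero (hm : 1 ≤ m) : rb2 m ≠ 0 := by
  intro h
  have hX := congrArg (pderiv ⟨0, hm⟩) h
  rw [pderiv_rb2, map_zero] at hX
  simp at hX

lemma lapB_rb2_pow_mul {p : ℕ} {f : MvPolynomial (Fin m) ℝ} (h : f ∈ Hb m p) (i : ℕ) :
    lapB m (rb2 m ^ (i + 1) * f) =
      (4 * (i + 1) * ((m:ℝ) / 2 + p + i)) • (rb2 m ^ i * f) := by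
  obtain ⟨hg, hk⟩ := h
  have step (i : ℕ) : lapB m (rb2 m ^ (i + 1) * f) = rb2 m * lapB m (rb2 m ^ i * f) +
      (2 * (m:ℝ) + 4 * (2 * i + p)) • (rb2 m ^ i * f) := by
    rw [pow_succ', mul_assoc, lapB_rb2_mul (rb2_pow_mul_isHomogeneous hg i)]
    push_cast
    rfl
  induction i with
  | zero =>
    rw [step]
    simp only [pow_zero, one_mul, LinearMap.mem_ker.mp hk, mul_zero, zero_add]
    congr 1
    push_cast
    ring
  | succ i ih =>
    rw [step, ih, mul_smul_comm, ← mul_assoc, ← pow_succ', ← add_smul]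
    push_cast
    congr 1
    ring

end Bosonic

lemma tmul_ne_zero_of_ne_zero {V W : Type*} [AddCommGroup V] [Module ℝ V] [AddCommGroup W]
    [Module ℝ W] {v : V} {w : W} (hv : v ≠ 0) (hw : w ≠ 0) : v ⊗ₜ[ℝ] w ≠ 0 := by
  intro h
  obtain ⟨φ, hφ⟩ : ∃ φ : Module.Dual ℝ V, φ v ≠ 0 := by
    by_contra! hc
    exact hv ((Module.forall_dual_apply_eq_zero_iff ℝ v).mp hc)
  obtain ⟨ψ, hψ⟩ : ∃ ψ : Module.Dual ℝ W, ψ w ≠ 0 := by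
    by_contra! hc
    exact hw ((Module.forall_dual_apply_eq_zero_iff ℝ w).mp hc)
  have := congrArg (TensorProduct.lift ((LinearMap.mul ℝ ℝ).compl₁₂ φ ψ)) h
  simp [hφ, hψ] at this

section Super

variable {m n}

/-- The element `∑ a_i x̲^{2(k−i)} x`^{2i}` of the radial algebra. -/
def radial (m n k : ℕ) (a : ℕ → ℝ) : SuperPoly m n :=
  ∑ i ∈ Finset.range (k+1), a i • (((rb2 m)^(k-i)) ⊗ₜ[ℝ] ((rf2 n)^i))

/-- The coefficients of `fkpq`. -/
def fkpqCoeff (m n k p q i : ℕ) : ℝ :=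
  (Nat.choose k i : ℝ) * ((n - q - i).factorial : ℝ) / Real.Gamma ((m:ℝ)/2 + p + k - i)

lemma radial_mul_tmul (k : ℕ) (a : ℕ → ℝ) (f : MvPolynomial (Fin m) ℝ) (ω : Grass n) :
    radial m n k a * (f ⊗ₜ[ℝ] ω) = ∑ i ∈ Finset.range (k+1),
      a i • ((rb2 m ^ (k-i) * f) ⊗ₜ[ℝ] (rf2 n ^ i * ω)) := by
  simp only [radial, Finset.sum_mul, smul_mul_assoc, Algebra.TensorProduct.tmul_mul_tmul]

lemma lap_radial_mul_tmul {p q : ℕ} (k : ℕ) (a : ℕ → ℝ) {f : MvPolynomial (Fin m) ℝ}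
    {ω : Grass n} (hf : f ∈ Hb m p) (hω : ω ∈ Hf n q) :
    lap m n (radial m n k a * (f ⊗ₜ[ℝ] ω)) = ∑ i ∈ Finset.range k,
      (4 * (((k:ℝ) - i) * ((m:ℝ) / 2 + p + k - i - 1) * a i +
        (i + 1) * ((q:ℝ) + i - n) * a (i + 1))) •
        ((rb2 m ^ (k-1-i) * f) ⊗ₜ[ℝ] (rf2 n ^ i * ω)) := by
  have hfk : lapB m f = 0 := hf.2
  have hωk : lapF n ω = 0 := hω.2
  rw [radial_mul_tmul, map_sum]
  simp only [lap, map_smul, LinearMap.add_apply, LinearMap.rTensor_tmul, LinearMap.lTensor_tmul,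
    smul_add, Finset.sum_add_distrib]
  rw [Finset.sum_range_succ, Finset.sum_range_succ' (fun i => a i •
    ((rb2 m ^ (k-i) * f) ⊗ₜ[ℝ] lapF n (rf2 n ^ i * ω)))]
  simp only [Nat.sub_self, pow_zero, one_mul, hfk, hωk, TensorProduct.zero_tmul,
    TensorProduct.tmul_zero, smul_zero, add_zero]
  rw [← Finset.sum_add_distrib]
  refine Finset.sum_congr rfl fun i hi => ?_
  rw [Finset.mem_range] at hi
  obtain ⟨l, rfl⟩ : ∃ l, k = l + i + 1 := ⟨k - i - 1, by omega⟩
  rw [show l + i + 1 - i = l + 1 by omega, show l + i + 1 - (i + 1) = l by omega,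
    show l + i + 1 - 1 - i = l by omega, lapB_rb2_pow_mul hf, lapF_rf2_pow_mul hω,
    ← TensorProduct.smul_tmul', TensorProduct.tmul_smul, smul_smul, smul_smul, ← add_smul]
  congr 1
  push_cast
  ring

/-- The projection onto bosonic degree `d` isolates single terms of a radial sum. -/
lemma rTensor_homogeneousComponent_sum {p k i : ℕ} (b : ℕ → ℝ) {f : MvPolynomial (Fin m) ℝ}
    (ω : Grass n) (hf : f ∈ Hb m p) (hi : i ≤ k) :
    LinearMap.rTensor (Grass n) (homogeneousComponent (2 * (k - i) + p))
      (∑ j ∈ Finset.range (k+1), b j • ((rb2 m ^ (k-j) * f) ⊗ₜ[ℝ] (rf2 n ^ j * ω))) =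
      b i • ((rb2 m ^ (k-i) * f) ⊗ₜ[ℝ] (rf2 n ^ i * ω)) := by
  rw [map_sum, Finset.sum_eq_single i]
  · rw [map_smul, LinearMap.rTensor_tmul, homogeneousComponent_of_mem
      (rb2_pow_mul_isHomogeneous hf.1 _), if_pos rfl]
  · intro j hj hji
    rw [Finset.mem_range] at hj
    rw [map_smul, LinearMap.rTensor_tmul, homogeneousComponent_of_mem
      (rb2_pow_mul_isHomogeneous hf.1 _), if_neg (by omega), TensorProduct.zero_tmul, smul_zero]
  · intro h
    exact absurd (Finset.mem_range.mpr (by omega)) h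

lemma eq_zero_of_sum_eq_zero (hm : 1 ≤ m) {p q k : ℕ} {b : ℕ → ℝ}
    {f : MvPolynomial (Fin m) ℝ} {ω : Grass n} (hf : f ∈ Hb m p) (hf0 : f ≠ 0)
    (hω : ω ∈ Hf n q) (hω0 : ω ≠ 0) (hk : q + k ≤ n)
    (h : ∑ j ∈ Finset.range (k+1), b j • ((rb2 m ^ (k-j) * f) ⊗ₜ[ℝ] (rf2 n ^ j * ω)) = 0)
    {i : ℕ} (hi : i ≤ k) : b i = 0 := by
  have hc := rTensor_homogeneousComponent_sum b ω hf hi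
  rw [h, map_zero, eq_comm, smul_eq_zero] at hc
  exact hc.resolve_right (tmul_ne_zero_of_ne_zero
    (mul_ne_zero (pow_ne_zero _ (rb2_ne_zero hm)) hf0) (rf2_pow_mul_ne_zero hω hω0 (by omega)))

lemma fkpqCoeff_succ (hm : 1 ≤ m) {p q k i : ℕ} (hk : q + k ≤ n) (hi : i < k) :
    ((k:ℝ) - i) * ((m:ℝ) / 2 + p + k - i - 1) * fkpqCoeff m n k p q i =
      (i + 1) * ((n:ℝ) - q - i) * fkpqCoeff m n k p q (i + 1) := by
  obtain ⟨l, rfl⟩ : ∃ l, k = i + l + 1 := ⟨k - i - 1, by omega⟩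
  obtain ⟨r, rfl⟩ : ∃ r, n = q + i + r + 1 := ⟨n - q - i - 1, by omega⟩
  have hs : (0:ℝ) < (m:ℝ) / 2 + p + l := by
    have : (1:ℝ) ≤ m := by exact_mod_cast hm
    positivity
  have hΓ := Real.Gamma_pos_of_pos hs
  have hchoose : ((i + l + 1).choose (i + 1) : ℝ) * (i + 1) =
      ((i + l + 1).choose i : ℝ) * (l + 1) := by
    have := Nat.choose_succ_right_eq (i + l + 1) i
    rw [show i + l + 1 - i = l + 1 by omega] at this
    exact_mod_cast this
  simp only [fkpqCoeff]
  rw [show q + i + r + 1 - q - i = r + 1 by omega,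
    show q + i + r + 1 - q - (i + 1) = r by omega, Nat.factorial_succ]
  push_cast
  rw [show (m:ℝ) / 2 + p + (i + l + 1) - i = (m:ℝ) / 2 + p + l + 1 by ring,
    show (m:ℝ) / 2 + p + (i + l + 1) - (i + 1) = (m:ℝ) / 2 + p + l by ring,
    Real.Gamma_add_one hs.ne', add_sub_cancel_right]
  generalize (m:ℝ) / 2 + p + l = s at hs hΓ ⊢
  field_simp
  linear_combination (-(r + 1 : ℝ)) * hchoose

end Super

/-- for p ≥ 0, 0 ≤ q < n, 0 ≤ k ≤ n − q and ℋ^b_p ≠ 0: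
(i) Δ(f_{k,p,q} H^b H^f) = 0 for all H^b ∈ ℋ^b_p, H^f ∈ ℋ^f_q;
(ii) f_{k,p,q}·(ℋ^b_p·ℋ^f_q) ≠ 0;
(iii) f_{k,p,q} is the unique polynomial ∑ a_i x̲^{2(k−i)} x`^{2i} with these two properties
whose leading coefficient is a_0 = (n−q)!/Γ(m/2+p+k). -/
theorem fkpq_spec (m n : ℕ) (hm : 1 ≤ m) (hn : 1 ≤ n)
    (p q k : ℕ) (hq : q < n) (hk : k ≤ n - q) (hHb : Hb m p ≠ ⊥) :
    -- (i)
    (∀ Hbp ∈ Hb m p, ∀ Hfq ∈ Hf n q,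
      lap m n (fkpq m n k p q * (Hbp ⊗ₜ[ℝ] Hfq)) = 0) ∧
    -- (ii)
    (Submodule.map (LinearMap.mulLeft ℝ (fkpq m n k p q)) (HbHf m n p q) ≠ ⊥) ∧
    -- (iii)
    (∀ a : ℕ → ℝ,
      (∀ Hbp ∈ Hb m p, ∀ Hfq ∈ Hf n q,
        lap m n ((∑ i ∈ Finset.range (k+1), a i • (((rb2 m)^(k-i)) ⊗ₜ[ℝ] ((rf2 n)^i))) *
          (Hbp ⊗ₜ[ℝ] Hfq)) = 0) →
      (Submodule.map
          (LinearMap.mulLeft ℝ (∑ i ∈ Finset.range (k+1),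
            a i • (((rb2 m)^(k-i)) ⊗ₜ[ℝ] ((rf2 n)^i)))) (HbHf m n p q) ≠ ⊥) →
      a 0 = ((n - q).factorial : ℝ) / Real.Gamma ((m:ℝ)/2 + p + k) →
      (∑ i ∈ Finset.range (k+1), a i • (((rb2 m)^(k-i)) ⊗ₜ[ℝ] ((rf2 n)^i))) =
        fkpq m n k p q) := by
  have hqk : q + k ≤ n := by omega
  obtain ⟨f, hf, hf0⟩ := (Submodule.ne_bot_iff _).mp hHb
  obtain ⟨ω, hω, hω0⟩ := exists_mem_Hf_ne_zero hq.le
  have hfkpq : fkpq m n k p q = radial m n k (fkpqCoeff m n k p q) := rfl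
  refine ⟨fun g hg η hη => ?_, fun hbot => ?_, fun a ha _ ha0 => ?_⟩
  · rw [hfkpq, lap_radial_mul_tmul k _ hg hη]
    refine Finset.sum_eq_zero fun i hi => ?_
    rw [fkpqCoeff_succ hm hqk (Finset.mem_range.mp hi)]
    convert zero_smul ℝ _
    ring
  · have hmem : fkpq m n k p q * (f ⊗ₜ[ℝ] ω) ∈
        Submodule.map (LinearMap.mulLeft ℝ (fkpq m n k p q)) (HbHf m n p q) :=
      ⟨_, Submodule.apply_mem_map₂ _ hf hω, rfl⟩
    rw [hbot, Submodule.mem_bot, hfkpq, radial_mul_tmul] at hmem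
    have h0 := eq_zero_of_sum_eq_zero hm hf hf0 hω hω0 hqk hmem (Nat.zero_le k)
    have hs : (0:ℝ) < (m:ℝ) / 2 + p + k := by
      have : (1:ℝ) ≤ m := by exact_mod_cast hm
      positivity
    have hpos : 0 < fkpqCoeff m n k p q 0 := by
      have := Real.Gamma_pos_of_pos hs
      simp only [fkpqCoeff, Nat.choose_zero_right, Nat.cast_zero, sub_zero]
      positivity
    exact hpos.ne' h0
  · have hlap := ha f hf ω hω
    change lap m n (radial m n k a * (f ⊗ₜ[ℝ] ω)) = 0 at hlap
    rw [lap_radial_mul_tmul k a hf hω] at hlap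
    have hcoeff (i : ℕ) (hi : i ≤ k) : a i = fkpqCoeff m n k p q i := by
      induction i with
      | zero => rw [ha0]; simp [fkpqCoeff]
      | succ i ih =>
        obtain ⟨l, rfl⟩ : ∃ l, k = l + 1 := ⟨k - 1, by omega⟩
        have hrec := eq_zero_of_sum_eq_zero hm hf hf0 hω hω0 (by omega) hlap
          (show i ≤ l by omega)
        have hsucc := fkpqCoeff_succ (p := p) hm hqk (show i < l + 1 by omega)
        rw [ih (by omega), hsucc] at hrec
        have hne : ((i:ℝ) + 1) * ((n:ℝ) - q - i) ≠ 0 := by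
          have : (q:ℝ) + i + 1 ≤ n := by exact_mod_cast (show q + i + 1 ≤ n by omega)
          have : (0:ℝ) < (n:ℝ) - q - i := by linarith
          positivity
        refine mul_left_cancel₀ hne ?_
        linear_combination (-1 / 4 : ℝ) * hrec
    refine Finset.sum_congr rfl fun i hi => ?_
    rw [hcoeff i (Nat.lt_succ_iff.mp (Finset.mem_range.mp hi))]
    rfl

end
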